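/- arXiv:1807.07011 — 3 statements merged into one kernel-verified Lean document; each statement's English description precedes it below -/
import Mathlib

section
/- Let p be a prime and let α be a nonzero real number. Then the set ψ_α(ℤ[1/p]) = {(αq, q) : q ∈ ℤ[1/p]} (where in the second coordinate q is viewed in ℚ_p via the canonical embedding ℚ → ℚ_p) is a subgroup of ℝ × ℚ_p which is discrete in the product topology. -/
/-- A rational number of the form `a / p ^ k` which is a `p`-adic integer is an integer. -/
theorem exists_intCast_eq_of_norm_padic_le_one (p : ℕ) [Fact p.Prime] (a : ℤ) (k : ℕ)
    (h : ‖(((a : ℚ) / (p : ℚ) ^ k : ℚ) : ℚ_[p])‖ ≤ 1) :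
    ∃ n : ℤ, (a : ℚ) / (p : ℚ) ^ k = n := by
  have hp : (0 : ℝ) < p := mod_cast (Fact.out : p.Prime).pos
  have hpq : (p : ℚ) ≠ 0 := mod_cast (Fact.out : p.Prime).ne_zero
  have ha : ‖(a : ℚ_[p])‖ ≤ (p : ℝ) ^ (-(k : ℤ)) := by
    push_cast at h
    rw [norm_div, norm_pow, Padic.norm_p, div_le_one (by positivity)] at h
    rwa [zpow_neg, zpow_natCast, ← inv_pow]
  obtain ⟨n, rfl⟩ := (Padic.norm_int_le_pow_iff_dvd a k).mp ha
  refine ⟨n, ?_⟩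
  push_cast
  field_simp

/-- The diagonal image `{(α * q, q) : q ∈ ℤ[1/p]}` as a subgroup of `ℝ × ℚ_[p]`. -/
def diagonalSubgroup (p : ℕ) [Fact p.Prime] (α : ℝ) : AddSubgroup (ℝ × ℚ_[p]) where
  carrier := {x : ℝ × ℚ_[p] | ∃ q : ℚ, (∃ (a : ℤ) (k : ℕ), q = (a : ℚ) / (p : ℚ) ^ k) ∧
    x = (α * (q : ℝ), ((q : ℚ) : ℚ_[p]))}
  zero_mem' := ⟨0, ⟨0, 0, by simp⟩, by simp [Prod.zero_eq_mk]⟩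
  add_mem' := by
    rintro _ _ ⟨q, ⟨a, k, hq⟩, rfl⟩ ⟨r, ⟨b, l, hr⟩, rfl⟩
    have hpq : (p : ℚ) ≠ 0 := mod_cast (Fact.out : p.Prime).ne_zero
    refine ⟨q + r, ⟨a * p ^ l + b * p ^ k, k + l, ?_⟩, ?_⟩
    · rw [hq, hr]
      push_cast
      field_simp
      ring
    · simp [mul_add]
  neg_mem' := by
    rintro _ ⟨q, ⟨a, k, hq⟩, rfl⟩
    exact ⟨-q, ⟨-a, k, by simp [hq, neg_div]⟩, by simp⟩

/-- An element of `diagonalSubgroup p α` close to zero is zero. -/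
theorem eq_zero_of_mem_diagonalSubgroup_of_norm_lt {p : ℕ} [Fact p.Prime] {α : ℝ}
    {x : ℝ × ℚ_[p]} (hx : x ∈ diagonalSubgroup p α) (h : ‖x‖ < min |α| 1) : x = 0 := by
  obtain ⟨q, ⟨a, k, hq⟩, rfl⟩ := hx
  obtain ⟨hα, hone⟩ := lt_min_iff.mp h
  obtain ⟨n, hn⟩ := exists_intCast_eq_of_norm_padic_le_one p a k
    (hq ▸ (norm_snd_le _).trans hone.le)
  have hlt : |α * (q : ℝ)| < |α| := (norm_fst_le _).trans_lt hα
  rw [hq, hn, abs_mul, Rat.cast_intCast] at hlt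
  have habs : |(n : ℝ)| < 1 := by nlinarith [abs_nonneg α, abs_nonneg (n : ℝ)]
  have hzero : n = 0 := Int.abs_lt_one_iff.mp (mod_cast habs)
  simp [hq, hn, hzero]

/-- For a prime `p` and a nonzero real `α`, the set
`ψ_α(ℤ[1/p]) = {(αq, q) : q ∈ ℤ[1/p]}` (with `q` viewed in `ℚ_p` via the canonical
embedding `ℚ → ℚ_p`) is a subgroup of `ℝ × ℚ_p` which is discrete in the product
topology. -/
theorem statement0 (p : ℕ) [Fact p.Prime] (α : ℝ) (hα : α ≠ 0) :
    ∃ S : AddSubgroup (ℝ × ℚ_[p]),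
      (S : Set (ℝ × ℚ_[p])) =
        {x : ℝ × ℚ_[p] | ∃ q : ℚ, (∃ (a : ℤ) (k : ℕ), q = (a : ℚ) / (p : ℚ) ^ k) ∧
          x = (α * (q : ℝ), ((q : ℚ) : ℚ_[p]))} ∧
      DiscreteTopology S := by
  refine ⟨diagonalSubgroup p α, rfl, discreteTopology_of_isOpen_singleton_zero ?_⟩
  refine Metric.isOpen_singleton_iff.mpr ⟨min |α| 1, lt_min (abs_pos.mpr hα) one_pos, ?_⟩
  intro y hy
  rw [dist_zero_right] at hy
  exact Subtype.ext (eq_zero_of_mem_diagonalSubgroup_of_norm_lt y.2 hy)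
end

section
/- Let p be a prime and let α be a nonzero real number. Then the quotient group (ℝ × ℚ_p)/ψ_α(ℤ[1/p]) is compact, where ψ_α(ℤ[1/p]) = {(αq, q) : q ∈ ℤ[1/p]} with q viewed in ℚ_p via the canonical embedding ℚ → ℚ_p. In particular ψ_α(ℤ[1/p]) is a lattice (a discrete co-compact subgroup) in ℝ × ℚ_p. -/
/-- Every `p`-adic number is congruent modulo `ℤ_p` to an element of `ℤ[1/p]`. -/
theorem Padic.exists_norm_sub_intCast_div_pow_le_one (p : ℕ) [Fact p.Prime] (y : ℚ_[p]) :
    ∃ (a : ℤ) (k : ℕ), ‖y - (((a : ℚ) / (p : ℚ) ^ k : ℚ) : ℚ_[p])‖ ≤ 1 := by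
  have hp : (1 : ℝ) < p := by exact_mod_cast (Fact.out : p.Prime).one_lt
  have hp0 : (p : ℚ_[p]) ≠ 0 := by exact_mod_cast (Fact.out : p.Prime).ne_zero
  obtain ⟨k, hk⟩ := pow_unbounded_of_one_lt ‖y‖ hp
  have hpk : (0 : ℝ) < (p : ℝ) ^ k := by positivity
  have hz : ‖(p : ℚ_[p]) ^ k * y‖ ≤ 1 := by
    rw [norm_mul, norm_pow, Padic.norm_p, inv_pow, inv_mul_le_iff₀ hpk]
    linarith
  obtain ⟨z, hzy⟩ : ∃ z : ℤ_[p], (z : ℚ_[p]) = (p : ℚ_[p]) ^ k * y := ⟨⟨_, hz⟩, rfl⟩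
  obtain ⟨a, ha⟩ := PadicInt.denseRange_intCast.exists_dist_lt z (inv_pos.2 hpk)
  refine ⟨a, k, ?_⟩
  have ha' : ‖(p : ℚ_[p]) ^ k * y - a‖ < ((p : ℝ) ^ k)⁻¹ := by
    rwa [dist_eq_norm, PadicInt.norm_def, PadicInt.coe_sub, hzy, PadicInt.coe_intCast] at ha
  have heq : y - (((a : ℚ) / (p : ℚ) ^ k : ℚ) : ℚ_[p])
      = ((p : ℚ_[p]) ^ k)⁻¹ * ((p : ℚ_[p]) ^ k * y - a) := by
    push_cast
    field_simp
  rw [heq, norm_mul, norm_inv, norm_pow, Padic.norm_p, inv_pow, inv_inv, ← le_div_iff₀' hpk,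
    one_div]
  exact ha'.le

/-- An element of `ℤ[1/p]` which is a `p`-adic integer and has absolute value less than one
vanishes. -/
theorem Padic.intCast_div_pow_eq_zero_of_norm_le_one (p : ℕ) [Fact p.Prime] (a : ℤ) (k : ℕ)
    (hpadic : ‖(((a : ℚ) / (p : ℚ) ^ k : ℚ) : ℚ_[p])‖ ≤ 1)
    (hreal : |(((a : ℚ) / (p : ℚ) ^ k : ℚ) : ℝ)| < 1) :
    (a : ℚ) / (p : ℚ) ^ k = 0 := by
  have hp0 : (p : ℚ) ≠ 0 := by exact_mod_cast (Fact.out : p.Prime).ne_zero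
  have hpk : (0 : ℝ) < (p : ℝ) ^ k := by
    have : (0 : ℝ) < p := by exact_mod_cast (Fact.out : p.Prime).pos
    positivity
  have hdvd : ((p : ℤ) ^ k) ∣ a := by
    rw [← Padic.norm_int_le_pow_iff_dvd]
    push_cast at hpadic
    rw [norm_div, norm_pow, Padic.norm_p, inv_pow, div_inv_eq_mul, ← le_div_iff₀ hpk] at hpadic
    simpa using hpadic
  obtain ⟨b, rfl⟩ := hdvd
  have hb : (((p : ℤ) ^ k * b : ℤ) : ℚ) / (p : ℚ) ^ k = b := by
    push_cast
    field_simp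
  rw [hb] at hreal ⊢
  have : |b| < 1 := by exact_mod_cast hreal
  simpa using Int.abs_lt_one_iff.1 this

/-- The image of `ℤ[1/p]` in `ℝ × ℚ_p` under `q ↦ (α * q, q)`. -/
def twistedDiagonal (p : ℕ) [Fact p.Prime] (α : ℝ) : AddSubgroup (ℝ × ℚ_[p]) where
  carrier := {x : ℝ × ℚ_[p] | ∃ q : ℚ, (∃ (a : ℤ) (k : ℕ), q = (a : ℚ) / (p : ℚ) ^ k) ∧
    x = (α * (q : ℝ), ((q : ℚ) : ℚ_[p]))}
  zero_mem' := ⟨0, ⟨0, 0, by simp⟩, by simp [Prod.ext_iff]⟩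
  add_mem' := by
    rintro _ _ ⟨_, ⟨a, k, rfl⟩, rfl⟩ ⟨_, ⟨b, l, rfl⟩, rfl⟩
    refine ⟨a / (p : ℚ) ^ k + b / (p : ℚ) ^ l, ⟨a * p ^ l + b * p ^ k, k + l, ?_⟩, ?_⟩
    · have hp0 : (p : ℚ) ≠ 0 := by exact_mod_cast (Fact.out : p.Prime).ne_zero
      push_cast
      field_simp
      ring
    · rw [Prod.mk_add_mk, Rat.cast_add, Rat.cast_add, mul_add]
  neg_mem' := by
    rintro _ ⟨_, ⟨a, k, rfl⟩, rfl⟩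
    refine ⟨-(a / (p : ℚ) ^ k), ⟨-a, k, by push_cast; ring⟩, ?_⟩
    rw [Prod.neg_mk, Rat.cast_neg, Rat.cast_neg, mul_neg]

theorem compactSpace_quotient_twistedDiagonal (p : ℕ) [Fact p.Prime] (α : ℝ) (hα : α ≠ 0) :
    CompactSpace ((ℝ × ℚ_[p]) ⧸ twistedDiagonal p α) := by
  have hK : IsCompact (Metric.closedBall (0 : ℝ) |α| ×ˢ Metric.closedBall (0 : ℚ_[p]) 1) :=
    (isCompact_closedBall _ _).prod (isCompact_closedBall _ _)
  refine ⟨(hK.image (continuous_quotient_mk' :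
    Continuous (QuotientAddGroup.mk (s := twistedDiagonal p α)))).of_isClosed_subset
      isClosed_univ ?_⟩
  rintro x -
  induction x using QuotientAddGroup.induction_on with | H x => ?_
  obtain ⟨r, y⟩ := x
  obtain ⟨a, k, hak⟩ := Padic.exists_norm_sub_intCast_div_pow_le_one p y
  set q : ℚ := (a : ℚ) / (p : ℚ) ^ k with hq
  set n : ℤ := ⌊r / α - q⌋ with hn
  refine ⟨(r - α * ((q + n : ℚ) : ℝ), y - ((q + n : ℚ) : ℚ_[p])), ⟨?_, ?_⟩, ?_⟩
  · have h : r - α * ((q + n : ℚ) : ℝ) = α * Int.fract (r / α - q) := by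
      rw [Int.fract, ← hn]
      push_cast
      field_simp
      ring
    rw [mem_closedBall_zero_iff, h, norm_mul, Real.norm_eq_abs, Real.norm_eq_abs, Int.abs_fract]
    exact mul_le_of_le_one_right (abs_nonneg _) (Int.fract_lt_one _).le
  · have h : y - ((q + n : ℚ) : ℚ_[p]) = (y - (q : ℚ_[p])) + ((-n : ℤ) : ℚ_[p]) := by
      push_cast
      ring
    rw [mem_closedBall_zero_iff, h]
    exact (Padic.nonarchimedean _ _).trans (max_le hak (Padic.norm_int_le_one _))
  · refine QuotientAddGroup.eq.2 ⟨q + n, ⟨a + n * p ^ k, k, ?_⟩, ?_⟩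
    · have hp0 : (p : ℚ) ≠ 0 := by exact_mod_cast (Fact.out : p.Prime).ne_zero
      rw [hq]
      push_cast
      field_simp
    · ext <;> simp

theorem discreteTopology_twistedDiagonal (p : ℕ) [Fact p.Prime] (α : ℝ) (hα : α ≠ 0) :
    DiscreteTopology (twistedDiagonal p α) := by
  refine discreteTopology_of_isOpen_singleton_zero ?_
  rw [Metric.isOpen_singleton_iff]
  refine ⟨min |α| 1, lt_min (abs_pos.2 hα) one_pos, ?_⟩
  rintro ⟨_, q, ⟨a, k, rfl⟩, rfl⟩ h
  rw [dist_zero_right, AddSubgroup.coe_norm, Prod.norm_def, max_lt_iff, lt_min_iff,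
    lt_min_iff] at h
  obtain ⟨⟨hr, -⟩, -, hy⟩ := h
  rw [norm_mul, Real.norm_eq_abs, Real.norm_eq_abs, mul_lt_iff_lt_one_right (abs_pos.2 hα)] at hr
  have h0 := Padic.intCast_div_pow_eq_zero_of_norm_le_one p a k hy.le hr
  ext <;> simp [h0]


/-- For a prime `p` and a nonzero real `α`, the quotient group
`(ℝ × ℚ_p)/ψ_α(ℤ[1/p])` is compact, where `ψ_α(ℤ[1/p]) = {(αq, q) : q ∈ ℤ[1/p]}`.
In particular `ψ_α(ℤ[1/p])` is a lattice (a discrete co-compact subgroup) in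
`ℝ × ℚ_p`. -/
theorem statement1 (p : ℕ) [Fact p.Prime] (α : ℝ) (hα : α ≠ 0) :
    ∃ S : AddSubgroup (ℝ × ℚ_[p]),
      (S : Set (ℝ × ℚ_[p])) =
        {x : ℝ × ℚ_[p] | ∃ q : ℚ, (∃ (a : ℤ) (k : ℕ), q = (a : ℚ) / (p : ℚ) ^ k) ∧
          x = (α * (q : ℝ), ((q : ℚ) : ℚ_[p]))} ∧
      CompactSpace ((ℝ × ℚ_[p]) ⧸ S) ∧ DiscreteTopology S := by
  exact ⟨twistedDiagonal p α, rfl, compactSpace_quotient_twistedDiagonal p α hα,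
    discreteTopology_twistedDiagonal p α hα⟩
end

section
/- Let p be a prime. The topological group ℚ_p is self-dual: there exists an isomorphism of topological groups between ℚ_p and its Pontryagin dual, i.e. the group of continuous group homomorphisms from the additive group ℚ_p to the circle group, equipped with pointwise multiplication and the compact-open topology. -/
open Topology

namespace Padic

variable {p : ℕ} [Fact p.Prime]

theorem exists_addChar_circle_apply_inv_ne_one (p : ℕ) [Fact p.Prime] :
    ∃ ψ : AddChar ℚ_[p] Circle, (∀ x, ‖x‖ ≤ 1 → ψ x = 1) ∧ ψ (p : ℚ_[p])⁻¹ ≠ 1 := by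
  let Z : AddSubgroup ℚ_[p] := (PadicInt.subring p).toAddSubgroup
  have hmem (x : ℚ_[p]) : x ∈ Z ↔ ‖x‖ ≤ 1 := Iff.rfl
  have hp : (QuotientAddGroup.mk (p : ℚ_[p])⁻¹ : ℚ_[p] ⧸ Z) ≠ 0 := by
    rw [Ne, QuotientAddGroup.eq_zero_iff, hmem, norm_inv, Padic.norm_p, inv_inv, not_le]
    exact_mod_cast (Fact.out : p.Prime).one_lt
  obtain ⟨c, hc⟩ := CharacterModule.exists_character_apply_ne_zero_of_ne_zero hp
  let c' : ℚ_[p] ⧸ Z →+ AddCircle (1 : ℚ) := c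
  let i : AddCircle (1 : ℚ) →+ AddCircle (1 : ℝ) :=
    QuotientAddGroup.map _ _ (Rat.castHom ℝ).toAddMonoidHom (by
      rw [AddSubgroup.zmultiples_le]
      exact ⟨1, by simp⟩)
  have hi : Function.Injective i := by
    rw [injective_iff_map_eq_zero]
    intro a
    induction a using QuotientAddGroup.induction_on with
    | H q =>
      intro h
      obtain ⟨n, hn⟩ := (QuotientAddGroup.eq_zero_iff ((q : ℚ) : ℝ)).1 h
      refine (QuotientAddGroup.eq_zero_iff q).2 ⟨n, ?_⟩
      have : (n : ℝ) = q := by simpa using hn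
      have : (n : ℚ) = q := by exact_mod_cast this
      simpa using this
  let j : ℚ_[p] →+ AddCircle (1 : ℝ) := i.comp (c'.comp (QuotientAddGroup.mk' Z))
  refine ⟨⟨fun x ↦ (j x).toCircle, by simp, fun x y ↦ by simp [AddCircle.toCircle_add]⟩, ?_, ?_⟩
  · intro x hx
    have : (QuotientAddGroup.mk' Z) x = 0 := (QuotientAddGroup.eq_zero_iff x).2 hx
    change (i (c' (QuotientAddGroup.mk' Z x))).toCircle = 1
    simp [this]
  · intro h
    change (i (c' _)).toCircle = 1 at h
    rw [← AddCircle.toCircle_zero (T := 1)] at h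
    have h₀ := AddCircle.injective_toCircle one_ne_zero h
    exact hc (hi (h₀.trans (map_zero i).symm))

theorem continuous_addChar_of_forall_norm_le_one {ψ : AddChar ℚ_[p] Circle}
    (hψ : ∀ x, ‖x‖ ≤ 1 → ψ x = 1) : Continuous ψ := by
  rw [continuous_iff_continuousAt]
  intro x
  refine continuousAt_const.congr (f := fun _ ↦ ψ x) ?_
  filter_upwards [Metric.ball_mem_nhds x one_pos] with y hy
  rw [Metric.mem_ball, dist_eq_norm] at hy
  rw [← sub_add_cancel y x, AddChar.map_add_eq_mul, hψ _ hy.le, one_mul]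

theorem exists_forall_norm_le_addChar_eq_one {χ : AddChar ℚ_[p] Circle} (hχ : Continuous χ) :
    ∃ n : ℕ, ∀ x, ‖x‖ ≤ ‖(p : ℚ_[p]) ^ n‖ → χ x = 1 := by
  have hU : χ ⁻¹' Circle.centeredArc (Real.pi / 2) ∈ 𝓝 (0 : ℚ_[p]) := by
    refine ((Circle.isOpen_centeredArc _).preimage hχ).mem_nhds ?_
    rw [Set.mem_preimage, AddChar.map_zero_eq_one,
      Circle.mem_centeredArc (by linarith [Real.pi_pos])]
    simp [Real.pi_pos]
  obtain ⟨ε, hε, hball⟩ := Metric.mem_nhds_iff.1 hU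
  obtain ⟨n, hn⟩ := exists_pow_lt_of_lt_one hε (Padic.norm_p_lt_one (p := p))
  refine ⟨n, fun x hx ↦ Circle.eq_one_of_forall_pow_mem_centeredArc_pi_div_two fun k _ ↦ ?_⟩
  rw [← AddChar.map_nsmul_eq_pow]
  refine hball ?_
  rw [mem_ball_zero_iff, nsmul_eq_mul, norm_mul]
  have hk : ‖(k : ℚ_[p])‖ ≤ 1 := by simpa using Padic.norm_int_le_one (p := p) k
  calc ‖(k : ℚ_[p])‖ * ‖x‖ ≤ 1 * ‖x‖ := by gcongr
    _ ≤ ‖(p : ℚ_[p])‖ ^ n := by simpa using hx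
    _ < ε := hn

theorem addChar_eq_of_forall_apply_inv_pow {χ φ : AddChar ℚ_[p] Circle}
    (hχ : ∀ x, ‖x‖ ≤ 1 → χ x = 1) (hφ : ∀ x, ‖x‖ ≤ 1 → φ x = 1)
    (h : ∀ k : ℕ, χ ((p : ℚ_[p])⁻¹ ^ k) = φ ((p : ℚ_[p])⁻¹ ^ k)) : χ = φ := by
  ext1 x
  have hp : (p : ℚ_[p]) ≠ 0 := by exact_mod_cast (Fact.out : p.Prime).ne_zero
  obtain ⟨k, hk⟩ : ∃ k : ℕ, ‖(p : ℚ_[p]) ^ k * x‖ ≤ 1 := by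
    obtain ⟨k, hk⟩ := exists_pow_lt_of_lt_one (inv_pos.2 (by positivity : 0 < ‖x‖ + 1))
      (Padic.norm_p_lt_one (p := p))
    refine ⟨k, ?_⟩
    rw [norm_mul, norm_pow]
    calc ‖(p : ℚ_[p])‖ ^ k * ‖x‖ ≤ (‖x‖ + 1)⁻¹ * (‖x‖ + 1) := by gcongr; linarith
      _ = 1 := inv_mul_cancel₀ (by positivity)
  let z : ℤ_[p] := ⟨_, hk⟩
  obtain ⟨w, hw⟩ := Ideal.mem_span_singleton'.1 (PadicInt.appr_spec k z)
  have hw' : (w : ℚ_[p]) * (p : ℚ_[p]) ^ k = (p : ℚ_[p]) ^ k * x - (z.appr k : ℚ_[p]) := by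
    have h := congrArg ((↑) : ℤ_[p] → ℚ_[p]) hw
    simp only [PadicInt.coe_mul, PadicInt.coe_pow, PadicInt.coe_sub, PadicInt.coe_natCast] at h
    exact h
  have hx : x = z.appr k • (p : ℚ_[p])⁻¹ ^ k + w := by
    rw [nsmul_eq_mul, inv_pow]
    field_simp
    linear_combination -hw'
  rw [hx, AddChar.map_add_eq_mul, AddChar.map_add_eq_mul, AddChar.map_nsmul_eq_pow,
    AddChar.map_nsmul_eq_pow, hχ _ w.2, hφ _ w.2, h]

theorem isPrimitiveRoot_addChar_apply_inv_pow {ψ : AddChar ℚ_[p] Circle}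
    (hψ : ∀ x, ‖x‖ ≤ 1 → ψ x = 1) (hψp : ψ (p : ℚ_[p])⁻¹ ≠ 1) (k : ℕ) :
    IsPrimitiveRoot (ψ ((p : ℚ_[p])⁻¹ ^ k)) (p ^ k) := by
  have hp : (p : ℚ_[p]) ≠ 0 := by exact_mod_cast (Fact.out : p.Prime).ne_zero
  cases k with
  | zero => simp [hψ 1 (by simp)]
  | succ k =>
    rw [← orderOf_eq_prime_pow (x := ψ ((p : ℚ_[p])⁻¹ ^ (k + 1))) (n := k) (p := p)]
    · exact IsPrimitiveRoot.orderOf _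
    · rw [← AddChar.map_nsmul_eq_pow]
      convert hψp using 3
      rw [nsmul_eq_mul, inv_pow]
      push_cast
      field_simp
      ring
    · rw [← AddChar.map_nsmul_eq_pow]
      convert hψ 1 (by simp) using 2
      rw [nsmul_eq_mul, inv_pow]
      push_cast
      field_simp

theorem exists_eq_mulShift_of_forall_norm_le_one {ψ χ : AddChar ℚ_[p] Circle}
    (hψ : ∀ x, ‖x‖ ≤ 1 → ψ x = 1) (hψp : ψ (p : ℚ_[p])⁻¹ ≠ 1)
    (hχ : ∀ x, ‖x‖ ≤ 1 → χ x = 1) : ∃ y : ℚ_[p], χ = ψ.mulShift y := by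
  have hp : (p : ℚ_[p]) ≠ 0 := by exact_mod_cast (Fact.out : p.Prime).ne_zero
  let S (k : ℕ) : Set ℤ_[p] :=
    {y | ψ ((y : ℚ_[p]) * (p : ℚ_[p])⁻¹ ^ k) = χ ((p : ℚ_[p])⁻¹ ^ k)}
  have hclosed (k : ℕ) : IsClosed (S k) :=
    isClosed_eq ((continuous_addChar_of_forall_norm_le_one hψ).comp
      (continuous_subtype_val.mul continuous_const)) continuous_const
  have hanti (k : ℕ) : S (k + 1) ⊆ S k := by
    intro y hy
    have hk : (p : ℚ_[p])⁻¹ ^ k = p • (p : ℚ_[p])⁻¹ ^ (k + 1) := by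
      rw [nsmul_eq_mul, pow_succ]
      field_simp
    change ψ _ = χ _
    rw [hk, mul_smul_comm, AddChar.map_nsmul_eq_pow, AddChar.map_nsmul_eq_pow]
    exact congrArg (· ^ p) hy
  have hne (k : ℕ) : (S k).Nonempty := by
    have hζ := (isPrimitiveRoot_addChar_apply_inv_pow hψ hψp k).map_of_injective
      (f := Circle.coeHom) Circle.coe_injective
    have hpk : NeZero (p ^ k) := ⟨pow_ne_zero _ (Fact.out : p.Prime).ne_zero⟩
    have hξ : χ ((p : ℚ_[p])⁻¹ ^ k) ^ p ^ k = 1 := by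
      rw [← AddChar.map_nsmul_eq_pow]
      convert hχ 1 (by simp) using 2
      rw [nsmul_eq_mul, inv_pow]
      push_cast
      field_simp
    obtain ⟨a, -, ha⟩ := hζ.eq_pow_of_pow_eq_one (ξ := (χ ((p : ℚ_[p])⁻¹ ^ k) : ℂ))
      (by exact_mod_cast congrArg ((↑) : Circle → ℂ) hξ)
    refine ⟨a, ?_⟩
    change ψ _ = χ _
    rw [PadicInt.coe_natCast, ← nsmul_eq_mul, AddChar.map_nsmul_eq_pow]
    exact Circle.coe_injective ((Circle.coe_pow _ _).trans ha)
  obtain ⟨y, hy⟩ := IsCompact.nonempty_iInter_of_sequence_nonempty_isCompact_isClosed S hanti hne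
    (hclosed 0).isCompact hclosed
  refine ⟨y, addChar_eq_of_forall_apply_inv_pow hχ (fun x hx ↦ ?_) fun k ↦ ?_⟩
  · rw [AddChar.mulShift_apply]
    refine hψ _ ?_
    rw [norm_mul]
    exact mul_le_one₀ y.2 (norm_nonneg _) hx
  · rw [AddChar.mulShift_apply]
    exact (Set.mem_iInter.1 hy k).symm

theorem exists_eq_mulShift_of_continuous {ψ χ : AddChar ℚ_[p] Circle}
    (hψ : ∀ x, ‖x‖ ≤ 1 → ψ x = 1) (hψp : ψ (p : ℚ_[p])⁻¹ ≠ 1) (hχ : Continuous χ) :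
    ∃ y : ℚ_[p], χ = ψ.mulShift y := by
  have hp : (p : ℚ_[p]) ≠ 0 := by exact_mod_cast (Fact.out : p.Prime).ne_zero
  obtain ⟨n, hn⟩ := exists_forall_norm_le_addChar_eq_one hχ
  obtain ⟨y, hy⟩ := exists_eq_mulShift_of_forall_norm_le_one
    (χ := χ.mulShift ((p : ℚ_[p]) ^ n)) hψ hψp fun x hx ↦ by
      rw [AddChar.mulShift_apply]
      refine hn _ ?_
      rw [norm_mul]
      exact mul_le_of_le_one_right (norm_nonneg _) hx
  refine ⟨y * ((p : ℚ_[p]) ^ n)⁻¹, ?_⟩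
  ext1 x
  have := DFunLike.congr_fun hy (((p : ℚ_[p]) ^ n)⁻¹ * x)
  rwa [AddChar.mulShift_apply, AddChar.mulShift_apply, mul_inv_cancel_left₀ (pow_ne_zero _ hp),
    ← mul_assoc] at this

/-- The homomorphism `y ↦ (x ↦ ψ (y * x))` from `ℚ_[p]` to its Pontryagin dual. -/
noncomputable def toPontryaginDual (ψ : AddChar ℚ_[p] Circle) (hψ : Continuous ψ) :
    Multiplicative ℚ_[p] →* PontryaginDual (Multiplicative ℚ_[p]) where
  toFun y :=
    { toFun := fun x ↦ ψ (y.toAdd * x.toAdd)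
      map_one' := by simp
      map_mul' := fun a b ↦ by simp [mul_add, AddChar.map_add_eq_mul]
      continuous_toFun := hψ.comp (continuous_const.mul continuous_toAdd) }
  map_one' := PontryaginDual.ext fun x ↦ by
    change ψ (0 * x.toAdd) = 1
    simp
  map_mul' a b := PontryaginDual.ext fun x ↦ by
    change ψ ((a.toAdd + b.toAdd) * x.toAdd) = ψ (a.toAdd * x.toAdd) * ψ (b.toAdd * x.toAdd)
    rw [add_mul, AddChar.map_add_eq_mul]

theorem toPontryaginDual_apply (ψ : AddChar ℚ_[p] Circle) (hψ : Continuous ψ)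
    (y x : Multiplicative ℚ_[p]) :
    toPontryaginDual ψ hψ y x = ψ (y.toAdd * x.toAdd) :=
  rfl

theorem continuous_toPontryaginDual (ψ : AddChar ℚ_[p] Circle) (hψ : Continuous ψ) :
    Continuous (toPontryaginDual ψ hψ) :=
  ContinuousMonoidHom.continuous_of_continuous_uncurry (toPontryaginDual ψ hψ)
    (hψ.comp ((continuous_toAdd.comp continuous_fst).mul (continuous_toAdd.comp continuous_snd)))

theorem injective_toPontryaginDual {ψ : AddChar ℚ_[p] Circle} (hψ : Continuous ψ)
    (hψp : ψ (p : ℚ_[p])⁻¹ ≠ 1) : Function.Injective (toPontryaginDual ψ hψ) := by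
  rw [injective_iff_map_eq_one]
  intro y hy
  by_contra hne
  have hy₀ : y.toAdd ≠ 0 := hne
  refine hψp ?_
  have := DFunLike.congr_fun hy (Multiplicative.ofAdd (y.toAdd⁻¹ * (p : ℚ_[p])⁻¹))
  rwa [toPontryaginDual_apply, toAdd_ofAdd, mul_inv_cancel_left₀ hy₀] at this

theorem surjective_toPontryaginDual {ψ : AddChar ℚ_[p] Circle}
    (hψ : ∀ x, ‖x‖ ≤ 1 → ψ x = 1) (hψp : ψ (p : ℚ_[p])⁻¹ ≠ 1) :
    Function.Surjective
      (toPontryaginDual ψ (continuous_addChar_of_forall_norm_le_one hψ)) := by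
  intro χ
  let χ' : AddChar ℚ_[p] Circle :=
    { toFun := fun x ↦ χ (Multiplicative.ofAdd x)
      map_zero_eq_one' := map_one χ
      map_add_eq_mul' := fun a b ↦ map_mul χ (Multiplicative.ofAdd a) (Multiplicative.ofAdd b) }
  obtain ⟨y, hy⟩ := exists_eq_mulShift_of_continuous (χ := χ') hψ hψp
    ((map_continuous χ).comp continuous_ofAdd)
  exact ⟨Multiplicative.ofAdd y, PontryaginDual.ext fun x ↦
    (DFunLike.congr_fun hy x.toAdd).symm⟩

end Padic

/-- For a prime `p`, the locally compact abelian group `ℚ_p` is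
self-dual: there is an isomorphism of topological groups between `ℚ_p` and its
Pontryagin dual (continuous characters into the circle group, with pointwise
multiplication and the compact-open topology). -/
theorem statement16 (p : ℕ) [Fact p.Prime] :
    ∃ e : ℚ_[p] ≃ₜ PontryaginDual (Multiplicative ℚ_[p]),
      ∀ x y : ℚ_[p], e (x + y) = e x * e y := by
  obtain ⟨ψ, hψ, hψp⟩ := Padic.exists_addChar_circle_apply_inv_ne_one p
  have hcont := Padic.continuous_addChar_of_forall_norm_le_one hψ
  have hF := Padic.continuous_toPontryaginDual ψ hcont
  have hsurj := Padic.surjective_toPontryaginDual hψ hψp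
  let e : Multiplicative ℚ_[p] ≃ₜ PontryaginDual (Multiplicative ℚ_[p]) :=
    (Equiv.ofBijective (Padic.toPontryaginDual ψ hcont)
      ⟨Padic.injective_toPontryaginDual hcont hψp, hsurj⟩).toHomeomorphOfContinuousOpen hF
      (MonoidHom.isOpenMap_of_sigmaCompact _ hsurj hF)
  let m : ℚ_[p] ≃ₜ Multiplicative ℚ_[p] :=
    ⟨Multiplicative.ofAdd, continuous_ofAdd, continuous_toAdd⟩
  exact ⟨m.trans e, fun x y ↦
    map_mul (Padic.toPontryaginDual ψ hcont) (Multiplicative.ofAdd x) (Multiplicative.ofAdd y)⟩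
end
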